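/- Fix integers k, l ≥ 1 and d ≥ 2k+1+l, and reals α, δ > 0, γ > 0 and β ≥ γ(1 + 1/(2k)). For every θ ∈ ℝ^d with θ_{2k+1} = 0 and max_{2k+2 ≤ i ≤ 2k+1+l} θ_i ≥ 0, one has F(θ) ≥ −(β−γ)²/(2α); consequently F(θ) − inf_{θ'∈ℝ^d} F(θ') ≥ (1/(2α)) [ γ²/(2k) + δ²/l ]. -/

import Mathlib

/-- The `i`-th coordinate (0-based) of `θ ∈ ℝ^d`, extended by `0` for out-of-range
indices. -/
def coordF (d : ℕ) (θ : EuclideanSpace ℝ (Fin d)) (i : ℕ) : ℝ :=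
  if h : i < d then θ ⟨i, h⟩ else 0

/-- The worst-case function used in the lower bound under global regularity (with 1-based
math indices translated to 0-based ones):
`F(θ) = γ ∑_{i=1}^{2k} |θ_{i+1} − θ_i| − β θ₁ + δ max_{2k+2 ≤ i ≤ 2k+1+l} θ_i + (α/2)‖θ‖₂²`. -/
noncomputable def hardF (d k l : ℕ) (α β γ δ : ℝ) (θ : EuclideanSpace ℝ (Fin d)) : ℝ :=
  γ * ∑ i ∈ Finset.range (2 * k), |coordF d θ (i + 1) - coordF d θ i|
    - β * coordF d θ 0
    + δ * sSup ((fun j => coordF d θ (2 * k + 1 + j)) '' Set.Iio l)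
    + α / 2 * ‖θ‖ ^ 2

lemma coordF_abs_le (d : ℕ) (θ : EuclideanSpace ℝ (Fin d)) (i : ℕ) : |coordF d θ i| ≤ ‖θ‖ := by
  unfold coordF
  split_ifs with h
  · simpa using PiLp.norm_apply_le θ ⟨i, h⟩
  · simp

lemma hardF_bdd (k l d : ℕ) (hl : 1 ≤ l) (α β γ δ : ℝ) (hα : 0 < α) (hγ : 0 < γ) (hδ : 0 < δ) :
    BddBelow (Set.range (hardF d k l α β γ δ)) := by
  refine ⟨-(|β| + δ) ^ 2 / (2 * α), ?_⟩
  rintro _ ⟨θ, rfl⟩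
  have h1 : 0 ≤ γ * ∑ i ∈ Finset.range (2 * k), |coordF d θ (i + 1) - coordF d θ i| := by
    positivity
  have h2 : β * coordF d θ 0 ≤ |β| * ‖θ‖ := by
    calc _ ≤ |β * coordF d θ 0| := le_abs_self _
      _ = |β| * |coordF d θ 0| := abs_mul _ _
      _ ≤ _ := by gcongr; exact coordF_abs_le _ _ _
  have h3 : -‖θ‖ ≤ sSup ((fun j => coordF d θ (2 * k + 1 + j)) '' Set.Iio l) := by
    refine le_trans (neg_le_of_abs_le (coordF_abs_le d θ (2 * k + 1 + 0))) ?_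
    exact le_csSup ((Set.finite_Iio l).image _).bddAbove ⟨0, by simp; omega, rfl⟩
  have h4 := mul_le_mul_of_nonneg_left h3 hδ.le
  have h5 : -(|β| + δ) ^ 2 / (2 * α) ≤ -(|β| + δ) * ‖θ‖ + α / 2 * ‖θ‖ ^ 2 := by
    rw [div_le_iff₀ (by positivity)]
    nlinarith [sq_nonneg (α * ‖θ‖ - (|β| + δ))]
  unfold hardF
  linarith

lemma hardF_first (k l d : ℕ) (α γ δ : ℝ) (hα : 0 < α) (hγ : 0 < γ) (hδ : 0 < δ)
    (β : ℝ) (θ : EuclideanSpace ℝ (Fin d))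
    (hθ : coordF d θ (2 * k) = 0)
    (hmax : 0 ≤ sSup ((fun j => coordF d θ (2 * k + 1 + j)) '' Set.Iio l)) :
    -(β - γ) ^ 2 / (2 * α) ≤ hardF d k l α β γ δ θ := by
  have h1 : coordF d θ 0 ≤ ∑ i ∈ Finset.range (2 * k), |coordF d θ (i + 1) - coordF d θ i| := by
    have h := Finset.abs_sum_le_sum_abs (fun i => coordF d θ (i + 1) - coordF d θ i)
      (Finset.range (2 * k))
    rw [Finset.sum_range_sub, hθ, zero_sub, abs_neg] at h
    exact (le_abs_self _).trans h
  have h2 : coordF d θ 0 ^ 2 ≤ ‖θ‖ ^ 2 := by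
    rw [← sq_abs]
    exact pow_le_pow_left₀ (abs_nonneg _) (coordF_abs_le d θ 0) 2
  have h3 := mul_le_mul_of_nonneg_left h1 hγ.le
  have h4 := mul_nonneg hδ.le hmax
  have h5 := mul_le_mul_of_nonneg_left h2 (show 0 ≤ α / 2 by positivity)
  have h6 : -(β - γ) ^ 2 / (2 * α) ≤
      (γ - β) * coordF d θ 0 + α / 2 * coordF d θ 0 ^ 2 := by
    rw [div_le_iff₀ (by positivity)]
    nlinarith [sq_nonneg (α * coordF d θ 0 - (β - γ))]
  unfold hardF
  linarith

noncomputable def witG (k l : ℕ) (a b c : ℝ) (i : ℕ) : ℝ :=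
  if i = 0 then a else if i < 2 * k + 1 then b else if i < 2 * k + 1 + l then c else 0

lemma hardF_wit (k l d : ℕ) (hk : 1 ≤ k) (hl : 1 ≤ l) (hd : 2 * k + 1 + l ≤ d)
    (α β γ δ a b c : ℝ) (hab : b ≤ a) :
    hardF d k l α β γ δ (WithLp.toLp 2 (fun i : Fin d => witG k l a b c i)) =
      γ * (a - b) - β * a + δ * c + α / 2 * (a ^ 2 + 2 * k * b ^ 2 + l * c ^ 2) := by
  have hc : ∀ i, i < d → coordF d (WithLp.toLp 2 (fun i : Fin d => witG k l a b c i)) i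
      = witG k l a b c i := by
    intro i hi
    simp [coordF, hi]
  have hsum : ∑ i ∈ Finset.range (2 * k),
      |coordF d (WithLp.toLp 2 (fun i : Fin d => witG k l a b c i)) (i + 1)
        - coordF d (WithLp.toLp 2 (fun i : Fin d => witG k l a b c i)) i| = a - b := by
    rw [Finset.sum_eq_single_of_mem 0 (by simp; omega)]
    · rw [hc _ (by omega), hc _ (by omega)]
      have : 0 + 1 < 2 * k + 1 := by omega
      simp only [witG, this, if_true]
      rw [abs_sub_comm]
      simpa using hab
    · intro i hi hi0
      have hi' := Finset.mem_range.1 hi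
      rw [hc _ (by omega), hc _ (by omega)]
      have h1 : i + 1 < 2 * k + 1 := by omega
      have h2 : i < 2 * k + 1 := by omega
      simp [witG, hi0, h2, hi']
  have hS : sSup ((fun j => coordF d (WithLp.toLp 2 (fun i : Fin d => witG k l a b c i))
      (2 * k + 1 + j)) '' Set.Iio l) = c := by
    have : ((fun j => coordF d (WithLp.toLp 2 (fun i : Fin d => witG k l a b c i))
      (2 * k + 1 + j)) '' Set.Iio l) = {c} := by
      have hj : ∀ j < l, coordF d (WithLp.toLp 2 (fun i : Fin d => witG k l a b c i))
          (2 * k + 1 + j) = c := by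
        intro j hj
        rw [hc _ (by omega)]
        unfold witG
        rw [if_neg (by omega), if_neg (by omega), if_pos (by omega)]
      ext x
      constructor
      · rintro ⟨j, h, rfl⟩
        exact hj j h
      · rintro rfl
        exact ⟨0, by simp; omega, hj 0 (by omega)⟩
    rw [this, csSup_singleton]
  have hN : ‖(WithLp.toLp 2 (fun i : Fin d => witG k l a b c i) : EuclideanSpace ℝ (Fin d))‖ ^ 2
      = a ^ 2 + 2 * k * b ^ 2 + l * c ^ 2 := by
    rw [EuclideanSpace.real_norm_sq_eq]
    have := Fin.sum_univ_eq_sum_range (fun i => witG k l a b c i ^ 2) d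
    refine this.trans ?_
    obtain ⟨e, rfl⟩ := Nat.exists_eq_add_of_le hd
    rw [Finset.sum_range_add, Finset.sum_range_add, Finset.sum_range_succ']
    have e1 : ∑ i ∈ Finset.range (2 * k), witG k l a b c (i + 1) ^ 2 = 2 * k * b ^ 2 := by
      rw [Finset.sum_congr rfl (g := fun _ => b ^ 2)]
      · simp
      · intro i hi
        have hi' := Finset.mem_range.1 hi
        simp [witG, hi']
    have e2 : ∑ i ∈ Finset.range l, witG k l a b c (2 * k + 1 + i) ^ 2 = l * c ^ 2 := by
      rw [Finset.sum_congr rfl (g := fun _ => c ^ 2)]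
      · simp
      · intro i hi
        have hi' := Finset.mem_range.1 hi
        unfold witG
        rw [if_neg (by omega), if_neg (by omega), if_pos (by omega)]
    have e3 : ∑ i ∈ Finset.range e, witG k l a b c (2 * k + 1 + l + i) ^ 2 = 0 := by
      apply Finset.sum_eq_zero
      intro i hi
      unfold witG
      rw [if_neg (by omega), if_neg (by omega), if_neg (by omega)]
      simp
    rw [e1, e2, e3]
    simp [witG]
    ring
  unfold hardF
  rw [hsum, hS, hN, hc 0 (by omega)]
  simp [witG]

/-- If `θ_{2k+1} = 0` (1-based) and the max over coordinates `2k+2, …, 2k+1+l` is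
nonnegative, then `F(θ) ≥ −(β−γ)²/(2α)`; consequently
`F(θ) − inf F ≥ (1/(2α))[γ²/(2k) + δ²/l]`. -/
theorem hardF_lower (k l d : ℕ) (hk : 1 ≤ k) (hl : 1 ≤ l) (hd : 2 * k + 1 + l ≤ d)
    (α γ δ : ℝ) (hα : 0 < α) (hγ : 0 < γ) (hδ : 0 < δ)
    (β : ℝ) (hβ : γ * (1 + 1 / (2 * (k : ℝ))) ≤ β)
    (θ : EuclideanSpace ℝ (Fin d))
    (hθ : coordF d θ (2 * k) = 0)
    (hmax : 0 ≤ sSup ((fun j => coordF d θ (2 * k + 1 + j)) '' Set.Iio l)) :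
    -(β - γ) ^ 2 / (2 * α) ≤ hardF d k l α β γ δ θ ∧
      (1 / (2 * α)) * (γ ^ 2 / (2 * (k : ℝ)) + δ ^ 2 / (l : ℝ)) ≤
        hardF d k l α β γ δ θ - ⨅ θ' : EuclideanSpace ℝ (Fin d), hardF d k l α β γ δ θ' := by
  have h1 := hardF_first k l d α γ δ hα hγ hδ β θ hθ hmax
  refine ⟨h1, ?_⟩
  have hk' : (0 : ℝ) < k := by exact_mod_cast hk
  have hl' : (0 : ℝ) < l := by exact_mod_cast hl
  have hab : γ / (2 * k * α) ≤ (β - γ) / α := by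
    rw [← div_div]
    gcongr
    have : γ * (1 + 1 / (2 * (k : ℝ))) = γ + γ / (2 * k) := by ring
    linarith
  have h2 := ciInf_le (hardF_bdd k l d hl α β γ δ hα hγ hδ)
    (WithLp.toLp 2 (fun i : Fin d => witG k l ((β - γ) / α) (γ / (2 * k * α)) (-(δ / (l * α))) i))
  rw [hardF_wit k l d hk hl hd α β γ δ _ _ _ hab] at h2
  have h3 : γ * ((β - γ) / α - γ / (2 * k * α)) - β * ((β - γ) / α) + δ * (-(δ / (l * α)))
      + α / 2 * (((β - γ) / α) ^ 2 + 2 * k * (γ / (2 * k * α)) ^ 2 + l * (-(δ / (l * α))) ^ 2)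
      = -(β - γ) ^ 2 / (2 * α) - (1 / (2 * α)) * (γ ^ 2 / (2 * (k : ℝ)) + δ ^ 2 / (l : ℝ)) := by
    field_simp
    ring
  linarith
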